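/- Let X* ∈ ℝ^{m×n} have rank r with balanced factorization (U*, V*) and W* = [U*; V*], let b = 𝒜(X*) (noiseless), and suppose 𝒜 satisfies RIP on rank-2r matrices with parameter δ_{2r} and on rank-4r matrices with parameter δ_{4r}, where 0 ≤ δ_{2r} ≤ δ_{4r} ≤ 1/100. Let W = [U; V] satisfy the first-order optimality condition for f+g, let R ∈ ℝ^{r×r} be an orthogonal matrix achieving the minimum of ‖W − W*R'‖_F over orthogonal R', and set Z = W − W*R, Z̃ = [Z_U; −Z_V]. Then the Hessian quadratic form of f+g at W in direction Z satisfies Σ_{i=1}^p ⟨B_i, ZWᵀ + WZᵀ⟩·⟨B_i, ZWᵀ⟩ + Σ_{i=1}^p (⟨B_i, WWᵀ⟩ − b_i)·⟨B_i, ZZᵀ⟩ + (1/4)·⟨Z̃W̃ᵀ + W̃Z̃ᵀ, ZWᵀ⟩ + (1/4)·⟨W̃W̃ᵀ, ZZᵀ⟩ ≤ −(1/10)·‖WWᵀ − W*W*ᵀ‖_F². -/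

import Mathlib

open Matrix BigOperators

noncomputable section

/-- Trace inner product `⟨X, Y⟩ = trace (Xᵀ * Y) = ∑ᵢⱼ Xᵢⱼ Yᵢⱼ`. -/
def ip {α β : Type*} [Fintype α] [Fintype β] (X Y : Matrix α β ℝ) : ℝ :=
  ∑ i, ∑ j, X i j * Y i j

/-- Frobenius norm. -/
def fnorm {α β : Type*} [Fintype α] [Fintype β] (X : Matrix α β ℝ) : ℝ :=
  Real.sqrt (∑ i, ∑ j, X i j ^ 2)

/-- Euclidean (ℓ₂) norm of a vector. -/
def vnorm {α : Type*} [Fintype α] (x : α → ℝ) : ℝ :=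
  Real.sqrt (∑ i, x i ^ 2)

/-- The linear operator `𝒜(X)ᵢ = ⟨Aᵢ, X⟩` satisfies the restricted isometry property on
rank-`k` matrices with parameter `δ`. -/
def RIP {m n p : ℕ} (A : Fin p → Matrix (Fin m) (Fin n) ℝ) (k : ℕ) (δ : ℝ) : Prop :=
  ∀ X : Matrix (Fin m) (Fin n) ℝ, X.rank ≤ k →
    (1 - δ) * fnorm X ^ 2 ≤ ∑ i, ip (A i) X ^ 2 ∧
      ∑ i, ip (A i) X ^ 2 ≤ (1 + δ) * fnorm X ^ 2

/-- Vertical stacking `[U; V]`. -/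
def stack {m n r : ℕ} (U : Matrix (Fin m) (Fin r) ℝ) (V : Matrix (Fin n) (Fin r) ℝ) :
    Matrix (Fin m ⊕ Fin n) (Fin r) ℝ :=
  Matrix.fromRows U V

/-- For `Z = [Z_U; Z_V]`, `tilde Z = [Z_U; -Z_V]` (negate the bottom block). -/
def tilde {m n r : ℕ} (Z : Matrix (Fin m ⊕ Fin n) (Fin r) ℝ) :
    Matrix (Fin m ⊕ Fin n) (Fin r) ℝ :=
  Matrix.of (Sum.elim (fun i j => Z (Sum.inl i) j) (fun i j => -Z (Sum.inr i) j))

/-- `Bᵢ = (1/2) · [[0, Aᵢ], [Aᵢᵀ, 0]]`. -/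
def Bmat {m n p : ℕ} (A : Fin p → Matrix (Fin m) (Fin n) ℝ) (i : Fin p) :
    Matrix (Fin m ⊕ Fin n) (Fin m ⊕ Fin n) ℝ :=
  (1 / 2 : ℝ) • Matrix.fromBlocks 0 (A i) (A i)ᵀ 0

/-- `(U, V)` is a balanced ("equally-footed") factorization of `X`: for some SVD
`X = A · diagonal S · Bᵀ` (with `A, B` having orthonormal columns and `S` the nonnegative
singular values) and some orthonormal `R`, `U = A · S^{1/2} · R` and `V = B · S^{1/2} · R`. -/
def IsBalanced {m n r : ℕ} (X : Matrix (Fin m) (Fin n) ℝ)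
    (U : Matrix (Fin m) (Fin r) ℝ) (V : Matrix (Fin n) (Fin r) ℝ) : Prop :=
  ∃ (A : Matrix (Fin m) (Fin r) ℝ) (B : Matrix (Fin n) (Fin r) ℝ)
    (S : Fin r → ℝ) (R : Matrix (Fin r) (Fin r) ℝ),
      Aᵀ * A = 1 ∧ Bᵀ * B = 1 ∧ (∀ i, 0 ≤ S i) ∧ Rᵀ * R = 1 ∧ R * Rᵀ = 1 ∧
      X = A * Matrix.diagonal S * Bᵀ ∧
      U = A * Matrix.diagonal (fun i => Real.sqrt (S i)) * R ∧
      V = B * Matrix.diagonal (fun i => Real.sqrt (S i)) * R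

/-- `Dist(U, V; X) = min ‖[U; V] − [U*; V*]‖_F` over balanced factorizations `(U*, V*)` of `X`. -/
def distW {m n r : ℕ} (U : Matrix (Fin m) (Fin r) ℝ) (V : Matrix (Fin n) (Fin r) ℝ)
    (X : Matrix (Fin m) (Fin n) ℝ) : ℝ :=
  sInf {d : ℝ | ∃ (U' : Matrix (Fin m) (Fin r) ℝ) (V' : Matrix (Fin n) (Fin r) ℝ),
    IsBalanced X U' V' ∧ d = fnorm (stack U V - stack U' V')}

/-- First-order optimality condition for `f + g` at `W = [U; V]`:
`∑ᵢ (⟨Bᵢ, WWᵀ⟩ − bᵢ) Bᵢ W + (1/4) W̃ W̃ᵀ W = 0`. -/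
def FirstOrderOpt {m n r p : ℕ} (A : Fin p → Matrix (Fin m) (Fin n) ℝ) (b : Fin p → ℝ)
    (U : Matrix (Fin m) (Fin r) ℝ) (V : Matrix (Fin n) (Fin r) ℝ) : Prop :=
  (∑ i, (ip (Bmat A i) (stack U V * (stack U V)ᵀ) - b i) • (Bmat A i * stack U V))
    + (1 / 4 : ℝ) • (stack U (-V) * (stack U (-V))ᵀ * stack U V) = 0

/-- The Hessian quadratic form of `f + g` at `W = [U; V]` in direction `Z`. -/
def hessForm {m n r p : ℕ} (A : Fin p → Matrix (Fin m) (Fin n) ℝ) (b : Fin p → ℝ)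
    (U : Matrix (Fin m) (Fin r) ℝ) (V : Matrix (Fin n) (Fin r) ℝ)
    (Z : Matrix (Fin m ⊕ Fin n) (Fin r) ℝ) : ℝ :=
  (∑ i, ip (Bmat A i) (Z * (stack U V)ᵀ + stack U V * Zᵀ) * ip (Bmat A i) (Z * (stack U V)ᵀ))
    + (∑ i, (ip (Bmat A i) (stack U V * (stack U V)ᵀ) - b i) * ip (Bmat A i) (Z * Zᵀ))
    + (1 / 4 : ℝ) * ip (tilde Z * (stack U (-V))ᵀ + stack U (-V) * (tilde Z)ᵀ)
        (Z * (stack U V)ᵀ)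
    + (1 / 4 : ℝ) * ip (stack U (-V) * (stack U (-V))ᵀ) (Z * Zᵀ)

/-- Second-order optimality condition for `f + g` at `W = [U; V]`: the Hessian quadratic
form is nonnegative in every direction `Z = [Z_U; Z_V]`. -/
def SecondOrderOpt {m n r p : ℕ} (A : Fin p → Matrix (Fin m) (Fin n) ℝ) (b : Fin p → ℝ)
    (U : Matrix (Fin m) (Fin r) ℝ) (V : Matrix (Fin n) (Fin r) ℝ) : Prop :=
  ∀ Z : Matrix (Fin m ⊕ Fin n) (Fin r) ℝ, 0 ≤ hessForm A b U V Z

section FrobeniusInnerProduct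

variable {α β γ κ : Type*} [Fintype α] [Fintype β] [Fintype γ] [Fintype κ]

theorem ip_eq_trace (X Y : Matrix α β ℝ) : ip X Y = (Xᵀ * Y).trace := by
  simp only [ip, Matrix.trace, Matrix.diag, Matrix.mul_apply, Matrix.transpose_apply]
  exact Finset.sum_comm

theorem ip_comm (X Y : Matrix α β ℝ) : ip X Y = ip Y X := by
  simp only [ip, mul_comm]

theorem ip_add_left (X X' Y : Matrix α β ℝ) : ip (X + X') Y = ip X Y + ip X' Y := by
  simp only [ip, Matrix.add_apply, add_mul, Finset.sum_add_distrib]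

theorem ip_add_right (X Y Y' : Matrix α β ℝ) : ip X (Y + Y') = ip X Y + ip X Y' := by
  rw [ip_comm, ip_add_left, ip_comm Y, ip_comm Y']

theorem ip_smul_left (c : ℝ) (X Y : Matrix α β ℝ) : ip (c • X) Y = c * ip X Y := by
  simp only [ip, Matrix.smul_apply, smul_eq_mul, Finset.mul_sum, mul_assoc]

theorem ip_smul_right (c : ℝ) (X Y : Matrix α β ℝ) : ip X (c • Y) = c * ip X Y := by
  rw [ip_comm, ip_smul_left, ip_comm]

theorem ip_sub_left (X X' Y : Matrix α β ℝ) : ip (X - X') Y = ip X Y - ip X' Y := by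
  simp only [ip, Matrix.sub_apply, sub_mul, Finset.sum_sub_distrib]

theorem ip_sub_right (X Y Y' : Matrix α β ℝ) : ip X (Y - Y') = ip X Y - ip X Y' := by
  rw [ip_comm, ip_sub_left, ip_comm Y, ip_comm Y']

theorem ip_zero_left (Y : Matrix α β ℝ) : ip 0 Y = 0 := by
  simp [ip]

theorem ip_sum_left {ι : Type*} (s : Finset ι) (X : ι → Matrix α β ℝ) (Y : Matrix α β ℝ) :
    ip (∑ i ∈ s, X i) Y = ∑ i ∈ s, ip (X i) Y := by
  classical
  induction s using Finset.induction_on with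
  | empty => simp [ip_zero_left]
  | insert a s ha ih => rw [Finset.sum_insert ha, Finset.sum_insert ha, ip_add_left, ih]

theorem ip_transpose (X Y : Matrix α β ℝ) : ip Xᵀ Yᵀ = ip X Y := by
  simp only [ip, Matrix.transpose_apply]
  exact Finset.sum_comm

theorem ip_self_nonneg (X : Matrix α β ℝ) : 0 ≤ ip X X :=
  Finset.sum_nonneg fun _ _ => Finset.sum_nonneg fun _ _ => mul_self_nonneg _

theorem fnorm_sq (X : Matrix α β ℝ) : fnorm X ^ 2 = ip X X := by
  have h : ∑ i, ∑ j, X i j ^ 2 = ip X X := by simp only [ip, sq]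
  rw [fnorm, h, Real.sq_sqrt (ip_self_nonneg X)]

theorem ip_mul_left (B : Matrix α γ ℝ) (W : Matrix γ β ℝ) (Z : Matrix α β ℝ) :
    ip (B * W) Z = ip B (Z * Wᵀ) := by
  rw [ip_eq_trace, ip_eq_trace, transpose_mul, ← Matrix.mul_assoc, Matrix.mul_assoc,
    Matrix.trace_mul_comm]

theorem ip_mul_transpose_mul_transpose (P : Matrix α γ ℝ) (Q : Matrix β γ ℝ)
    (S : Matrix α κ ℝ) (L : Matrix β κ ℝ) :
    ip (P * Qᵀ) (S * Lᵀ) = ip (Sᵀ * P) (Lᵀ * Q) := by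
  rw [ip_eq_trace, ip_eq_trace, transpose_mul, transpose_mul, transpose_transpose,
    transpose_transpose, Matrix.mul_assoc, Matrix.trace_mul_comm]
  simp only [Matrix.mul_assoc]

theorem ip_fromBlocks (P P' : Matrix α γ ℝ) (Q Q' : Matrix α κ ℝ) (S S' : Matrix β γ ℝ)
    (L L' : Matrix β κ ℝ) :
    ip (fromBlocks P Q S L) (fromBlocks P' Q' S' L') =
      ip P P' + ip Q Q' + ip S S' + ip L L' := by
  simp only [ip, Fintype.sum_sum_type, fromBlocks_apply₁₁, fromBlocks_apply₁₂,
    fromBlocks_apply₂₁, fromBlocks_apply₂₂, Finset.sum_add_distrib]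
  ring

end FrobeniusInnerProduct

section Procrustes

variable {ι : Type*} [DecidableEq ι]

/-- The rotation of the coordinate plane spanned by `i` and `j`. -/
def planeRotation (i j : ι) (c s : ℝ) : Matrix ι ι ℝ :=
  1 + (c - 1) • (Matrix.single i i 1 + Matrix.single j j 1) +
    s • (Matrix.single i j 1 - Matrix.single j i 1)

theorem planeRotation_transpose (i j : ι) (c s : ℝ) :
    (planeRotation i j c s)ᵀ = planeRotation i j c (-s) := by
  simp only [planeRotation, transpose_add, transpose_smul, transpose_sub, transpose_one,
    Matrix.transpose_single]
  module

variable [Fintype ι]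

theorem planeRotation_transpose_mul_self {i j : ι} (hij : i ≠ j) {c s : ℝ}
    (h : c ^ 2 + s ^ 2 = 1) : (planeRotation i j c s)ᵀ * planeRotation i j c s = 1 := by
  have hs : s * s = 1 - c * c := by linarith
  rw [planeRotation_transpose]
  simp only [planeRotation, Matrix.add_mul, Matrix.mul_add, Matrix.sub_mul, Matrix.mul_sub,
    Matrix.smul_mul, Matrix.mul_smul, Matrix.single_mul_single_same,
    Matrix.single_mul_single_of_ne _ _ _ _ hij, Matrix.single_mul_single_of_ne _ _ _ _ hij.symm,
    Matrix.one_mul, smul_smul, mul_one, smul_add, smul_sub, smul_zero]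
  simp only [mul_neg, hs]
  module

theorem ip_single (i j : ι) (N : Matrix ι ι ℝ) : ip (Matrix.single i j 1) N = N i j := by
  rw [ip, Finset.sum_eq_single i, Finset.sum_eq_single j] <;>
    simp +contextual [Matrix.single_apply, eq_comm]

theorem ip_planeRotation (i j : ι) (c s : ℝ) (N : Matrix ι ι ℝ) :
    ip (planeRotation i j c s) N =
      ip 1 N + (c - 1) * (N i i + N j j) + s * (N i j - N j i) := by
  simp only [planeRotation, ip_add_left, ip_smul_left, ip_sub_left, ip_single]

/-- A matrix whose trace cannot be increased by an orthogonal transformation is symmetric. -/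
theorem transpose_eq_of_ip_orthogonal_le {N : Matrix ι ι ℝ}
    (h : ∀ Q : Matrix ι ι ℝ, Qᵀ * Q = 1 → ip Q N ≤ ip 1 N) : Nᵀ = N := by
  ext i j
  rw [transpose_apply]
  by_cases hij : i = j
  · rw [hij]
  set x := N i i + N j j with hx
  set y := N i j - N j i with hy
  by_cases h0 : x ^ 2 + y ^ 2 = 0
  · nlinarith [sq_nonneg x, sq_nonneg y]
  have hpos : 0 < x ^ 2 + y ^ 2 := lt_of_le_of_ne (by positivity) (Ne.symm h0)
  set d := Real.sqrt (x ^ 2 + y ^ 2)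
  have hd : 0 < d := Real.sqrt_pos.2 hpos
  have hd2 : d ^ 2 = x ^ 2 + y ^ 2 := Real.sq_sqrt hpos.le
  have hcs : (x / d) ^ 2 + (y / d) ^ 2 = 1 := by
    field_simp
    exact hd2.symm
  have hle := h _ (planeRotation_transpose_mul_self hij hcs)
  rw [ip_planeRotation, ← hx, ← hy] at hle
  have hdx : d ≤ x := by
    have hsum : x / d * x + y / d * y = d := by
      field_simp
      exact hd2.symm
    linarith
  have hy0 : y = 0 := by
    have : y ^ 2 ≤ 0 := by nlinarith
    nlinarith [sq_nonneg y]
  linarith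

/-- A matrix whose trace cannot be increased by an orthogonal transformation induces a
nonnegative quadratic form. -/
theorem dotProduct_mulVec_nonneg_of_ip_orthogonal_le {N : Matrix ι ι ℝ}
    (h : ∀ Q : Matrix ι ι ℝ, Qᵀ * Q = 1 → ip Q N ≤ ip 1 N) (v : ι → ℝ) :
    0 ≤ v ⬝ᵥ N *ᵥ v := by
  by_cases hv : v = 0
  · simp [hv]
  have hpos : 0 < v ⬝ᵥ v :=
    lt_of_le_of_ne (Finset.sum_nonneg fun _ _ => mul_self_nonneg _)
      (fun h0 => hv (dotProduct_self_eq_zero.1 h0.symm))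
  have hle := h (1 - (2 / (v ⬝ᵥ v)) • vecMulVec v v) (by
    simp only [transpose_sub, transpose_one, transpose_smul, transpose_vecMulVec, Matrix.sub_mul,
      Matrix.mul_sub, Matrix.one_mul, Matrix.mul_one, Matrix.smul_mul, Matrix.mul_smul,
      vecMulVec_mul_vecMulVec, smul_smul, vecMulVec_smul]
    rw [div_mul_cancel₀ 2 hpos.ne']
    module)
  have hip : ip (vecMulVec v v) N = v ⬝ᵥ N *ᵥ v := by
    simp only [ip, vecMulVec_apply, dotProduct, mulVec, Finset.mul_sum]
    exact Finset.sum_congr rfl fun _ _ => Finset.sum_congr rfl fun _ _ => by ring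
  rw [ip_sub_left, ip_smul_left, hip] at hle
  have h2 : 0 ≤ 2 / (v ⬝ᵥ v) * (v ⬝ᵥ N *ᵥ v) := by linarith
  exact nonneg_of_mul_nonneg_right h2 (by positivity)

/-- Optimality in the orthogonal Procrustes problem, in terms of the cross-Gram matrix. -/
theorem ip_orthogonal_le_of_fnorm_sub_min {α : Type*} [Fintype α] {W T : Matrix α ι ℝ}
    (hmin : ∀ Q : Matrix ι ι ℝ, Qᵀ * Q = 1 → fnorm (W - T) ≤ fnorm (W - T * Q))
    (Q : Matrix ι ι ℝ) (hQ : Qᵀ * Q = 1) : ip Q (Tᵀ * W) ≤ ip 1 (Tᵀ * W) := by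
  have hsq : fnorm (W - T) ^ 2 ≤ fnorm (W - T * Q) ^ 2 :=
    pow_le_pow_left₀ (Real.sqrt_nonneg _) (hmin Q hQ) 2
  have hTQ : ip (T * Q) (T * Q) = ip T T := by
    rw [ip_mul_left, Matrix.mul_assoc, mul_eq_one_comm.1 hQ, Matrix.mul_one]
  have hcross : ∀ P : Matrix ι ι ℝ, ip (T * P) W = ip P (Tᵀ * W) := fun P => by
    rw [ip_eq_trace, ip_eq_trace, transpose_mul, Matrix.mul_assoc]
  have h1 : ip T W = ip 1 (Tᵀ * W) := by rw [← hcross, Matrix.mul_one]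
  simp only [fnorm_sq, ip_sub_left, ip_sub_right, hTQ, ip_comm W, hcross, h1] at hsq
  linarith

end Procrustes

section FactorDifference

variable {α ι : Type*} [Fintype ι]

theorem sub_mul_transpose_add (W T : Matrix α ι ℝ) :
    (W - T) * Wᵀ + W * (W - T)ᵀ = (W * Wᵀ - T * Tᵀ) + (W - T) * (W - T)ᵀ := by
  simp only [transpose_sub, Matrix.sub_mul, Matrix.mul_sub]
  abel

variable [Fintype α]

theorem ip_transpose_mul_self_nonneg {N : Matrix ι ι ℝ} (hN : ∀ v, 0 ≤ v ⬝ᵥ N *ᵥ v)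
    (Z : Matrix α ι ℝ) : 0 ≤ ip N (Zᵀ * Z) := by
  have h : ip N (Zᵀ * Z) = ∑ i, Z i ⬝ᵥ N *ᵥ Z i := by
    simp only [ip, Matrix.mul_apply, transpose_apply, dotProduct, mulVec, Finset.mul_sum]
    rw [Finset.sum_comm' (t' := Finset.univ) (s' := fun _ => Finset.univ) (by simp)]
    rw [Finset.sum_congr rfl fun _ _ => Finset.sum_comm]
    rw [Finset.sum_comm]
    rw [Finset.sum_congr rfl fun _ _ => Finset.sum_comm]
    exact Finset.sum_congr rfl fun _ _ => Finset.sum_congr rfl fun _ _ =>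
      Finset.sum_congr rfl fun _ _ => by ring
  rw [h]
  exact Finset.sum_nonneg fun i _ => hN _

theorem ip_sub_gram_le {W T : Matrix α ι ℝ} (hsymm : (Tᵀ * W)ᵀ = Tᵀ * W)
    (hpsd : ∀ v, 0 ≤ v ⬝ᵥ (Tᵀ * W) *ᵥ v) :
    ip ((W - T) * (W - T)ᵀ) ((W - T) * (W - T)ᵀ) ≤
      2 * ip (W * Wᵀ - T * Tᵀ) (W * Wᵀ - T * Tᵀ) := by
  set Z := W - T with hZ
  have hW : W = T + Z := by rw [hZ]; abel
  have hΔ : W * Wᵀ - T * Tᵀ = Z * Tᵀ + T * Zᵀ + Z * Zᵀ := by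
    rw [hW]
    simp only [transpose_add, Matrix.add_mul, Matrix.mul_add]
    abel
  have hN : Tᵀ * W = Tᵀ * T + Tᵀ * Z := by rw [hW, Matrix.mul_add]
  have hQ : Zᵀ * T = Tᵀ * Z := by
    have hZT : Tᵀ * Z = Tᵀ * W - Tᵀ * T := by rw [hN]; abel
    have := congrArg transpose hZT
    rwa [transpose_sub, hsymm, transpose_mul Tᵀ T, transpose_transpose, ← hZT, transpose_mul,
      transpose_transpose] at this
  have hpos := ip_transpose_mul_self_nonneg hpsd Z
  have hsq := ip_self_nonneg (Tᵀ * Z + (1 / 2 : ℝ) • (Zᵀ * Z))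
  rw [hΔ]
  simp only [hN, ip_add_left, ip_add_right, ip_smul_left, ip_smul_right,
    ip_mul_transpose_mul_transpose, hQ] at hpos hsq ⊢
  have e1 := ip_comm (Tᵀ * T) (Zᵀ * Z)
  have e2 := ip_comm (Tᵀ * Z) (Zᵀ * Z)
  linarith

end FactorDifference

section Blocks

variable {m n r p : ℕ}

theorem stack_mul_stack_transpose (U S : Matrix (Fin m) (Fin r) ℝ)
    (V Q : Matrix (Fin n) (Fin r) ℝ) :
    stack U V * (stack S Q)ᵀ = fromBlocks (U * Sᵀ) (U * Qᵀ) (V * Sᵀ) (V * Qᵀ) := by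
  rw [stack, stack, transpose_fromRows, fromRows_mul_fromCols]

theorem stack_transpose_mul_stack (U S : Matrix (Fin m) (Fin r) ℝ)
    (V Q : Matrix (Fin n) (Fin r) ℝ) : (stack U V)ᵀ * stack S Q = Uᵀ * S + Vᵀ * Q := by
  rw [stack, stack, transpose_fromRows, fromCols_mul_fromRows]

theorem stack_sub_stack (U S : Matrix (Fin m) (Fin r) ℝ) (V Q : Matrix (Fin n) (Fin r) ℝ) :
    stack U V - stack S Q = stack (U - S) (V - Q) := by
  ext i j
  cases i <;> rfl

theorem stack_mul (U : Matrix (Fin m) (Fin r) ℝ) (V : Matrix (Fin n) (Fin r) ℝ)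
    (R : Matrix (Fin r) (Fin r) ℝ) : stack U V * R = stack (U * R) (V * R) := by
  rw [stack, stack, fromRows_mul]

theorem tilde_stack (U : Matrix (Fin m) (Fin r) ℝ) (V : Matrix (Fin n) (Fin r) ℝ) :
    tilde (stack U V) = stack U (-V) := by
  ext i j
  cases i <;> rfl

theorem ip_Bmat_fromBlocks (A : Fin p → Matrix (Fin m) (Fin n) ℝ) (i : Fin p)
    (P : Matrix (Fin m) (Fin m) ℝ) (Q : Matrix (Fin m) (Fin n) ℝ)
    (S : Matrix (Fin n) (Fin m) ℝ) (L : Matrix (Fin n) (Fin n) ℝ) :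
    ip (Bmat A i) (fromBlocks P Q S L) = 1 / 2 * (ip (A i) Q + ip (A i) Sᵀ) := by
  rw [Bmat, ip_smul_left, ip_fromBlocks, ip_zero_left, ip_zero_left, ← ip_transpose _ S,
    transpose_transpose]
  ring

theorem ip_Bmat_transpose (A : Fin p → Matrix (Fin m) (Fin n) ℝ) (i : Fin p)
    (M : Matrix (Fin m ⊕ Fin n) (Fin m ⊕ Fin n) ℝ) :
    ip (Bmat A i) Mᵀ = ip (Bmat A i) M := by
  have h : (Bmat A i)ᵀ = Bmat A i := by
    simp [Bmat, fromBlocks_transpose]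
  rw [← ip_transpose, h, transpose_transpose]

theorem ip_Bmat_stack_self (A : Fin p → Matrix (Fin m) (Fin n) ℝ) (i : Fin p)
    (U : Matrix (Fin m) (Fin r) ℝ) (V : Matrix (Fin n) (Fin r) ℝ) :
    ip (Bmat A i) (stack U V * (stack U V)ᵀ) = ip (A i) (U * Vᵀ) := by
  rw [stack_mul_stack_transpose, ip_Bmat_fromBlocks, transpose_mul, transpose_transpose]
  ring

/-- The regularizer's share of the Hessian form, after eliminating the gradient term, when
the displacement `W - Z` from the critical point is balanced. -/
theorem regularizer_form_eq (U YU : Matrix (Fin m) (Fin r) ℝ) (V YV : Matrix (Fin n) (Fin r) ℝ)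
    (hbal : (U - YU)ᵀ * (U - YU) = (V - YV)ᵀ * (V - YV)) :
    -ip (stack U (-V) * (stack U (-V))ᵀ) (stack YU YV * (stack U V)ᵀ)
        + 1 / 4 * ip (stack YU (-YV) * (stack U (-V))ᵀ + stack U (-V) * (stack YU (-YV))ᵀ)
            (stack YU YV * (stack U V)ᵀ)
        + 1 / 4 * ip (stack U (-V) * (stack U (-V))ᵀ) (stack YU YV * (stack YU YV)ᵀ) =
      -(3 / 8) * ip (Uᵀ * U - Vᵀ * V) (Uᵀ * U - Vᵀ * V)
        + 1 / 8 * ip (YUᵀ * YU - YVᵀ * YV) (YUᵀ * YU - YVᵀ * YV) := by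
  set G := Uᵀ * U - Vᵀ * V with hG
  set H := YUᵀ * U - YVᵀ * V with hH
  have hHT : Hᵀ = Uᵀ * YU - Vᵀ * YV := by
    simp only [hH, transpose_sub, transpose_mul, transpose_transpose]
  have hGT : Gᵀ = G := by
    simp only [hG, transpose_sub, transpose_mul, transpose_transpose]
  have hE : YUᵀ * YU - YVᵀ * YV = H + Hᵀ - G := by
    rw [hHT, hH, hG]
    simp only [transpose_sub, Matrix.sub_mul, Matrix.mul_sub] at hbal
    rw [← sub_eq_zero] at hbal ⊢
    rw [← hbal]
    abel
  have e1 : Uᵀ * U + Vᵀ * -V = G := by rw [hG, Matrix.mul_neg, sub_eq_add_neg]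
  have e2 : YUᵀ * U + YVᵀ * -V = H := by rw [hH, Matrix.mul_neg, sub_eq_add_neg]
  have e3 : Uᵀ * YU + Vᵀ * -YV = Hᵀ := by rw [hHT, Matrix.mul_neg, sub_eq_add_neg]
  have e4 : YUᵀ * YU + YVᵀ * -YV = H + Hᵀ - G := by
    rw [← hE, Matrix.mul_neg, sub_eq_add_neg]
  have hHG : ip Hᵀ G = ip H G := by rw [← ip_transpose, transpose_transpose, hGT]
  have hHH : ip Hᵀ Hᵀ = ip H H := ip_transpose H H
  simp only [ip_add_left, ip_mul_transpose_mul_transpose, stack_transpose_mul_stack, e1, e2, e3,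
    e4, hE, ip_sub_left, ip_sub_right, ip_add_right, hHG, hHH, ip_comm G, ip_comm Hᵀ H]
  ring

theorem hessForm_eq_of_firstOrderOpt {A : Fin p → Matrix (Fin m) (Fin n) ℝ} {b : Fin p → ℝ}
    {U S : Matrix (Fin m) (Fin r) ℝ} {V Q : Matrix (Fin n) (Fin r) ℝ}
    (h : FirstOrderOpt A b U V) (hbal : Sᵀ * S = Qᵀ * Q)
    (hb : ∀ i, b i = ip (A i) (S * Qᵀ)) :
    hessForm A b U V (stack (U - S) (V - Q)) =
      -(3 / 2) * ∑ i, ip (A i) (U * Vᵀ - S * Qᵀ) ^ 2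
        + 1 / 2 * ∑ i, ip (A i) ((U - S) * (V - Q)ᵀ) ^ 2
        - 3 / 8 * ip (Uᵀ * U - Vᵀ * V) (Uᵀ * U - Vᵀ * V)
        + 1 / 8 * ip ((U - S)ᵀ * (U - S) - (V - Q)ᵀ * (V - Q))
            ((U - S)ᵀ * (U - S) - (V - Q)ᵀ * (V - Q)) := by
  have hreg := regularizer_form_eq U (U - S) V (V - Q) (by simpa using hbal)
  let x : Fin p → ℝ := fun i => ip (A i) (U * Vᵀ - S * Qᵀ)
  let z : Fin p → ℝ := fun i => ip (A i) ((U - S) * (V - Q)ᵀ)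
  have hres : ∀ i, ip (Bmat A i) (stack U V * (stack U V)ᵀ) - b i = x i := fun i => by
    rw [ip_Bmat_stack_self, hb, ← ip_sub_right]
  have hzz : ∀ i, ip (Bmat A i) (stack (U - S) (V - Q) * (stack (U - S) (V - Q))ᵀ) = z i :=
    fun i => ip_Bmat_stack_self A i _ _
  have hdir : ∀ i, ip (Bmat A i)
      (stack (U - S) (V - Q) * (stack U V)ᵀ + stack U V * (stack (U - S) (V - Q))ᵀ) =
        x i + z i := fun i => by
    have hid := sub_mul_transpose_add (stack U V) (stack S Q)
    rw [stack_sub_stack] at hid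
    rw [hid, ip_add_right, hzz, ip_sub_right, ip_Bmat_stack_self, ip_Bmat_stack_self,
      ← ip_sub_right]
  have hhalf : ∀ i, ip (Bmat A i) (stack (U - S) (V - Q) * (stack U V)ᵀ) =
      1 / 2 * (x i + z i) := fun i => by
    have htr : stack U V * (stack (U - S) (V - Q))ᵀ =
        (stack (U - S) (V - Q) * (stack U V)ᵀ)ᵀ := by
      rw [transpose_mul, transpose_transpose]
    have := hdir i
    rw [ip_add_right, htr, ip_Bmat_transpose] at this
    linarith
  have hgrad := congrArg (fun M => ip M (stack (U - S) (V - Q))) h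
  simp only [ip_add_left, ip_sum_left, ip_smul_left, ip_zero_left,
    ip_mul_left _ (stack U V) (stack (U - S) (V - Q)), hres, hhalf] at hgrad
  have hsum : (∑ i, (x i + z i) * (1 / 2 * (x i + z i))) + ∑ i, x i * z i =
      -(3 / 2) * ∑ i, x i ^ 2 + 1 / 2 * ∑ i, z i ^ 2
        + 4 * ∑ i, x i * (1 / 2 * (x i + z i)) := by
    simp only [Finset.mul_sum, ← Finset.sum_add_distrib]
    exact Finset.sum_congr rfl fun _ _ => by ring
  simp only [hessForm, hdir, hhalf, hres, hzz, tilde_stack]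
  change _ = -(3 / 2) * ∑ i, x i ^ 2 + 1 / 2 * ∑ i, z i ^ 2 - _ + _
  linarith

theorem fnorm_sq_stack_gram_sub (U S : Matrix (Fin m) (Fin r) ℝ)
    (V Q : Matrix (Fin n) (Fin r) ℝ) :
    fnorm (stack U V * (stack U V)ᵀ - stack S Q * (stack S Q)ᵀ) ^ 2 =
      ip (U * Uᵀ - S * Sᵀ) (U * Uᵀ - S * Sᵀ) + ip (V * Vᵀ - Q * Qᵀ) (V * Vᵀ - Q * Qᵀ)
        + 2 * ip (U * Vᵀ - S * Qᵀ) (U * Vᵀ - S * Qᵀ) := by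
  have hT : V * Uᵀ - Q * Sᵀ = (U * Vᵀ - S * Qᵀ)ᵀ := by
    simp only [transpose_sub, transpose_mul, transpose_transpose]
  rw [fnorm_sq, stack_mul_stack_transpose, stack_mul_stack_transpose, sub_eq_add_neg,
    fromBlocks_neg, fromBlocks_add]
  simp only [← sub_eq_add_neg]
  rw [ip_fromBlocks, hT, ip_transpose]
  ring

theorem ip_diagonal_blocks_sub_offDiagonal_le (U S : Matrix (Fin m) (Fin r) ℝ)
    (V Q : Matrix (Fin n) (Fin r) ℝ) (hbal : Sᵀ * S = Qᵀ * Q) :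
    ip (U * Uᵀ - S * Sᵀ) (U * Uᵀ - S * Sᵀ) + ip (V * Vᵀ - Q * Qᵀ) (V * Vᵀ - Q * Qᵀ)
        - 2 * ip (U * Vᵀ - S * Qᵀ) (U * Vᵀ - S * Qᵀ) ≤
      ip (Uᵀ * U - Vᵀ * V) (Uᵀ * U - Vᵀ * V) := by
  have h := ip_self_nonneg (Uᵀ * S - Vᵀ * Q)
  simp only [ip_sub_left, ip_sub_right, ip_mul_transpose_mul_transpose, hbal,
    ip_comm (Vᵀ * V) (Uᵀ * U), ip_comm (Vᵀ * Q) (Uᵀ * S)] at h ⊢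
  have e1 : ip (Sᵀ * U) (Sᵀ * U) = ip (Uᵀ * S) (Uᵀ * S) := by
    rw [← ip_transpose]; simp only [transpose_mul, transpose_transpose]
  have e2 : ip (Qᵀ * V) (Qᵀ * V) = ip (Vᵀ * Q) (Vᵀ * Q) := by
    rw [← ip_transpose]; simp only [transpose_mul, transpose_transpose]
  have e3 : ip (Sᵀ * U) (Qᵀ * V) = ip (Uᵀ * S) (Vᵀ * Q) := by
    rw [← ip_transpose]; simp only [transpose_mul, transpose_transpose]
  rw [e1, e2, e3]
  linarith

theorem rank_mul_transpose_le (U : Matrix (Fin m) (Fin r) ℝ) (V : Matrix (Fin n) (Fin r) ℝ) :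
    (U * Vᵀ).rank ≤ r :=
  (rank_mul_le_left U Vᵀ).trans (by simpa using rank_le_width U)

theorem rank_mul_transpose_sub_le (U S : Matrix (Fin m) (Fin r) ℝ)
    (V Q : Matrix (Fin n) (Fin r) ℝ) : (U * Vᵀ - S * Qᵀ).rank ≤ 2 * r := by
  have h : U * Vᵀ - S * Qᵀ = fromCols U (-S) * fromRows Vᵀ Qᵀ := by
    rw [fromCols_mul_fromRows, Matrix.neg_mul, sub_eq_add_neg]
  rw [h]
  refine (rank_mul_le_left _ _).trans ((rank_le_card_width _).trans ?_)
  simp [two_mul]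

end Blocks

theorem IsBalanced.mul_transpose {m n r : ℕ} {X : Matrix (Fin m) (Fin n) ℝ}
    {U : Matrix (Fin m) (Fin r) ℝ} {V : Matrix (Fin n) (Fin r) ℝ} (h : IsBalanced X U V) :
    U * Vᵀ = X := by
  obtain ⟨A, B, S, R, -, -, hS, -, hR, rfl, rfl, rfl⟩ := h
  simp only [transpose_mul, diagonal_transpose, Matrix.mul_assoc]
  rw [← Matrix.mul_assoc R, hR, Matrix.one_mul, ← Matrix.mul_assoc (diagonal _) (diagonal _),
    diagonal_mul_diagonal]
  simp only [Real.mul_self_sqrt (hS _)]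

theorem IsBalanced.transpose_mul_self_eq {m n r : ℕ} {X : Matrix (Fin m) (Fin n) ℝ}
    {U : Matrix (Fin m) (Fin r) ℝ} {V : Matrix (Fin n) (Fin r) ℝ} (h : IsBalanced X U V) :
    Uᵀ * U = Vᵀ * V := by
  obtain ⟨A, B, S, R, hA, hB, -, -, -, -, rfl, rfl⟩ := h
  simp only [transpose_mul, Matrix.mul_assoc]
  rw [← Matrix.mul_assoc Aᵀ, ← Matrix.mul_assoc Bᵀ, hA, hB]

/-- in the noiseless setting with `0 ≤ δ₂ᵣ ≤ δ₄ᵣ ≤ 1/100`, at any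
first-order critical point `W = [U; V]`, the Hessian quadratic form of `f + g` in the
direction `Z = W − W*R` (with `R` the minimizing orthogonal matrix) satisfies
`∇²(f+g)(W)[Z, Z] ≤ −(1/10)‖WWᵀ − W*W*ᵀ‖_F²`. -/
theorem hessian_negative_direction {m n r p : ℕ}
    (A : Fin p → Matrix (Fin m) (Fin n) ℝ) (δ2r δ4r : ℝ)
    (hRIP2 : RIP A (2 * r) δ2r) (hRIP4 : RIP A (4 * r) δ4r)
    (hδ0 : 0 ≤ δ2r) (hδ24 : δ2r ≤ δ4r) (hδ4 : δ4r ≤ 1 / 100)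
    (X : Matrix (Fin m) (Fin n) ℝ) (hrank : X.rank = r)
    (Us : Matrix (Fin m) (Fin r) ℝ) (Vs : Matrix (Fin n) (Fin r) ℝ)
    (hbal : IsBalanced X Us Vs)
    (b : Fin p → ℝ) (hb : b = fun i => ip (A i) X)
    (U : Matrix (Fin m) (Fin r) ℝ) (V : Matrix (Fin n) (Fin r) ℝ)
    (h1 : FirstOrderOpt A b U V)
    (R : Matrix (Fin r) (Fin r) ℝ) (hR : Rᵀ * R = 1) (hR' : R * Rᵀ = 1)
    (hmin : ∀ R' : Matrix (Fin r) (Fin r) ℝ, R'ᵀ * R' = 1 → R' * R'ᵀ = 1 →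
      fnorm (stack U V - stack Us Vs * R) ≤ fnorm (stack U V - stack Us Vs * R')) :
    hessForm A b U V (stack U V - stack Us Vs * R)
      ≤ -(1 / 10 : ℝ) *
          fnorm (stack U V * (stack U V)ᵀ - stack Us Vs * (stack Us Vs)ᵀ) ^ 2 := by
  set S := Us * R with hS
  set Q := Vs * R with hQ
  have hSQ : stack Us Vs * R = stack S Q := stack_mul Us Vs R
  have hgram : stack Us Vs * (stack Us Vs)ᵀ = stack S Q * (stack S Q)ᵀ := by
    rw [← hSQ, transpose_mul, Matrix.mul_assoc, ← Matrix.mul_assoc R, hR', Matrix.one_mul]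
  have hX : S * Qᵀ = X := by
    rw [hS, hQ, transpose_mul, Matrix.mul_assoc, ← Matrix.mul_assoc R, hR', Matrix.one_mul,
      hbal.mul_transpose]
  have hSQ_bal : Sᵀ * S = Qᵀ * Q := by
    simp only [hS, hQ, transpose_mul, Matrix.mul_assoc]
    rw [← Matrix.mul_assoc Usᵀ, ← Matrix.mul_assoc Vsᵀ, hbal.transpose_mul_self_eq]
  have hproc := ip_orthogonal_le_of_fnorm_sub_min (W := stack U V) (T := stack S Q)
    fun P hP => by
      have hRP : (R * P)ᵀ * (R * P) = 1 := by
        rw [transpose_mul, Matrix.mul_assoc, ← Matrix.mul_assoc Rᵀ, hR, Matrix.one_mul, hP]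
      have := hmin (R * P) hRP (mul_eq_one_comm.1 hRP)
      rwa [← Matrix.mul_assoc, hSQ] at this
  have hZZ := ip_sub_gram_le (transpose_eq_of_ip_orthogonal_le hproc)
    (dotProduct_mulVec_nonneg_of_ip_orthogonal_le hproc)
  have hswap : (V - Q) * (U - S)ᵀ = ((U - S) * (V - Q)ᵀ)ᵀ := by
    rw [transpose_mul, transpose_transpose]
  rw [← fnorm_sq (stack U V * _ - _), stack_sub_stack, stack_mul_stack_transpose (U - S),
    ip_fromBlocks, hswap, ip_transpose] at hZZ
  have hΔ_blocks := fnorm_sq_stack_gram_sub U S V Q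
  have hG := ip_diagonal_blocks_sub_offDiagonal_le U S V Q hSQ_bal
  have hE : ip ((U - S)ᵀ * (U - S) - (V - Q)ᵀ * (V - Q))
      ((U - S)ᵀ * (U - S) - (V - Q)ᵀ * (V - Q)) =
        ip ((U - S) * (U - S)ᵀ) ((U - S) * (U - S)ᵀ)
          + ip ((V - Q) * (V - Q)ᵀ) ((V - Q) * (V - Q)ᵀ)
          - 2 * ip ((U - S) * (V - Q)ᵀ) ((U - S) * (V - Q)ᵀ) := by
    simp only [ip_sub_left _ _ (_ - _), ip_sub_right _ (_ * _) (_ * _),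
      ip_mul_transpose_mul_transpose]
    rw [ip_comm ((V - Q)ᵀ * (V - Q))]
    ring
  have hΔ_rip := (hRIP2 _ (rank_mul_transpose_sub_le U S V Q)).1
  have hZ_rip := (hRIP2 ((U - S) * (V - Q)ᵀ)
    ((rank_mul_transpose_le _ _).trans (by omega))).2
  rw [hSQ, stack_sub_stack, hgram,
    hessForm_eq_of_firstOrderOpt h1 hSQ_bal fun i => by rw [hb, hX], hE]
  rw [fnorm_sq] at hΔ_rip hZ_rip
  have hδ : δ2r ≤ 1 / 100 := hδ24.trans hδ4
  have hΔ_err := mul_le_mul_of_nonneg_right hδ (ip_self_nonneg (U * Vᵀ - S * Qᵀ))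
  have hZ_err := mul_le_mul_of_nonneg_right hδ (ip_self_nonneg ((U - S) * (V - Q)ᵀ))
  linarith [ip_self_nonneg (U * Uᵀ - S * Sᵀ), ip_self_nonneg (V * Vᵀ - Q * Qᵀ),
    ip_self_nonneg (U * Vᵀ - S * Qᵀ),
    ip_self_nonneg ((U - S) * (U - S)ᵀ), ip_self_nonneg ((V - Q) * (V - Q)ᵀ)]
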